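/- Let n ≥ 2, l a nonnegative integer and β a multi-index with n+1 ≤ 2l+|β| ≤ 2n, and set p = 2l+|β|+2. Let f : (0,∞)×ℝⁿ → ℝⁿ be continuous, have parabolic scaling of order p, and satisfy (1+|y|)^{|β|} f(1,·) ∈ L¹(ℝⁿ). Then there exists a real polynomial Q of degree at most ⌊n − l − |β|/2⌋ such that, as t → +∞, ∫₀^t ∫_{ℝⁿ} (−s)^l (−y)^β f(1+s,y) dy ds = (log t) · ∫_{ℝⁿ} (−1)^l (−y)^β f(1,y) dy + Q(t^{−1}) + o(t^{−n+l+|β|/2}). -/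

import Mathlib

open MeasureTheory Real Filter
open scoped ENNReal Topology

noncomputable section

abbrev Spc (n : ℕ) := EuclideanSpace ℝ (Fin n)

theorem integral_pow_div_one_add_pow (l : ℕ) {t : ℝ} (ht : 0 ≤ t) :
    ∫ s in (0 : ℝ)..t, s ^ l / (1 + s) ^ (l + 1) =
      Real.log (1 + t) - ∑ j ∈ Finset.range l, (t / (1 + t)) ^ (j + 1) / ((j : ℝ) + 1) := by
  have hderiv : ∀ s : ℝ, 0 ≤ s → ∀ l : ℕ, HasDerivAt
      (fun t : ℝ => Real.log (1 + t) -
        ∑ j ∈ Finset.range l, (t / (1 + t)) ^ (j + 1) / ((j : ℝ) + 1))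
      (s ^ l / (1 + s) ^ (l + 1)) s := by
    intro s hs l
    have h1 : (1 + s) ≠ 0 := by positivity
    have hadd : HasDerivAt (fun t : ℝ => 1 + t) 1 s := (hasDerivAt_id s).const_add 1
    induction l with
    | zero => simpa using hadd.log h1
    | succ l ih =>
      have hq := ((((hasDerivAt_id' s).div hadd h1).pow (l + 1)).div_const ((l : ℝ) + 1))
      have hl : (l : ℝ) + 1 ≠ 0 := by positivity
      refine ((ih.sub hq).congr_deriv ?_).congr_of_eventuallyEq (Eventually.of_forall fun t => ?_)
      · push_cast
        simp only [Pi.div_apply, div_pow]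
        field_simp
        ring
      · simp [Finset.sum_range_succ, sub_sub]
  have hcont : ContinuousOn (fun s : ℝ => s ^ l / (1 + s) ^ (l + 1)) (Set.uIcc 0 t) := by
    rw [Set.uIcc_of_le ht]
    refine ContinuousOn.div (by fun_prop) (by fun_prop) fun s hs => ?_
    have := hs.1
    positivity
  rw [intervalIntegral.integral_eq_sub_of_hasDerivAt
    (fun s hs => hderiv s (by rw [Set.uIcc_of_le ht] at hs; exact hs.1) l)
    hcont.intervalIntegrable]
  simp

theorem AnalyticAt.exists_polynomial_isBigO {A : ℝ → ℝ} (hA : AnalyticAt ℝ A 0) (K : ℕ) :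
    ∃ P : Polynomial ℝ, P.natDegree ≤ K ∧
      (fun x => A x - P.eval x) =O[𝓝 0] fun x => x ^ (K + 1) := by
  obtain ⟨p, hp⟩ := hA
  refine ⟨∑ k ∈ Finset.range (K + 1), Polynomial.C (p.coeff k) * Polynomial.X ^ k, ?_, ?_⟩
  · refine Polynomial.natDegree_sum_le_of_forall_le _ _ fun k hk => ?_
    exact (Polynomial.natDegree_C_mul_X_pow_le _ _).trans
      (Nat.lt_succ_iff.mp (Finset.mem_range.mp hk))
  · have h := hp.isBigO_sub_partialSum_pow (K + 1)
    refine (h.congr_left fun x => ?_).trans (Asymptotics.IsBigO.of_norm_right ?_)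
    · simp only [FormalMultilinearSeries.partialSum, Polynomial.eval_finsetSum, zero_add,
        FormalMultilinearSeries.apply_eq_pow_smul_coeff, Polynomial.eval_mul, Polynomial.eval_C,
        Polynomial.eval_pow, Polynomial.eval_X, smul_eq_mul, mul_comm]
    · simpa [norm_pow] using Asymptotics.isBigO_refl (fun x : ℝ => ‖x‖ ^ (K + 1)) (𝓝 0)

theorem abs_prod_neg_pow_le {n : ℕ} (β : Fin n → ℕ) (y : Spc n) :
    |∏ h, (-(y h)) ^ β h| ≤ (1 + ‖y‖) ^ ∑ h, β h := by
  rw [Finset.abs_prod, ← Finset.prod_pow_eq_pow_sum]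
  refine Finset.prod_le_prod (fun _ _ => abs_nonneg _) fun h _ => ?_
  rw [abs_pow, abs_neg]
  have := PiLp.norm_apply_le y h
  rw [Real.norm_eq_abs] at this
  gcongr
  linarith

theorem prod_neg_smul_pow {n : ℕ} (β : Fin n → ℕ) (r : ℝ) (y : Spc n) :
    ∏ h, (-((r • y) h)) ^ β h = r ^ (∑ h, β h) * ∏ h, (-(y h)) ^ β h := by
  rw [← Finset.prod_pow_eq_pow_sum, ← Finset.prod_mul_distrib]
  refine Finset.prod_congr rfl fun h _ => ?_
  rw [← mul_pow]
  simp

/-- Integrating the self-similar profile in space first reduces the space-time moment to a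
one-dimensional integral. -/
theorem setIntegral_moment_eq_smul {n l : ℕ} (β : Fin n → ℕ) (f : ℝ → Spc n → Spc n)
    (hcont : ContinuousOn (fun q : ℝ × Spc n => f q.1 q.2) (Set.Ioi 0 ×ˢ Set.univ))
    (hscale : ∀ lam > (0 : ℝ), ∀ t > (0 : ℝ), ∀ x : Spc n,
      lam ^ (n + (2 * l + (∑ h, β h) + 2)) • f (lam ^ 2 * t) (lam • x) = f t x)
    (hint : Integrable (fun y : Spc n => (1 + ‖y‖) ^ (∑ h, β h) • f 1 y) volume)
    {t : ℝ} (ht : 0 ≤ t) :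
    ∫ sy in (Set.Ioc (0 : ℝ) t) ×ˢ (Set.univ : Set (Spc n)),
        ((-sy.1) ^ l * ∏ h, (-(sy.2 h)) ^ (β h)) • f (1 + sy.1) sy.2 =
      (∫ s in (0 : ℝ)..t, s ^ l / (1 + s) ^ (l + 1)) •
        ∫ y : Spc n, ((-1 : ℝ) ^ l * ∏ h, (-(y h)) ^ (β h)) • f 1 y := by
  set g : Spc n → Spc n := fun y => ((-1 : ℝ) ^ l * ∏ h, (-(y h)) ^ (β h)) • f 1 y with hg
  set F : ℝ × Spc n → Spc n := fun sy =>
    ((-sy.1) ^ l * ∏ h, (-(sy.2 h)) ^ (β h)) • f (1 + sy.1) sy.2 with hF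
  set w : ℝ → ℝ := fun s => s ^ l / (1 + s) ^ (l + 1) with hw
  have hf1 : Continuous (f 1) := by
    rw [← continuousOn_univ]
    exact hcont.comp (f := fun y : Spc n => ((1 : ℝ), y)) (by fun_prop) fun y _ => by simp
  have hgcont : Continuous g := by fun_prop
  have hgint : Integrable g := by
    refine hint.mono hgcont.aestronglyMeasurable (Eventually.of_forall fun y => ?_)
    rw [hg, norm_smul, norm_smul, norm_mul, norm_pow, norm_neg, norm_one, one_pow, one_mul,
      Real.norm_eq_abs, Real.norm_of_nonneg (by positivity)]
    gcongr
    exact abs_prod_neg_pow_le β y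
  have hslice : ∀ s : ℝ, 0 < s → ∀ y, F (s, y) =
      (w s * ((√(1 + s))⁻¹) ^ n) • g ((√(1 + s))⁻¹ • y) := by
    intro s hs y
    have hr : 0 < √(1 + s) := Real.sqrt_pos.2 (by linarith)
    have hsq : √(1 + s) ^ 2 = 1 + s := Real.sq_sqrt (by linarith)
    have h1 := hscale (√(1 + s))⁻¹ (by positivity) (1 + s) (by linarith) y
    rw [inv_pow (√(1 + s)) 2, hsq, inv_mul_cancel₀ (by linarith)] at h1
    simp only [hF, hg, hw]
    rw [← h1, smul_smul, smul_smul, prod_neg_smul_pow]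
    congr 1
    generalize √(1 + s) = r at hr hsq
    generalize ∏ h, (-(y h)) ^ β h = m
    rw [← hsq, neg_pow s]
    simp only [inv_pow, pow_add, pow_mul, pow_one]
    field_simp
  have hwnn : ∀ s : ℝ, 0 < s → 0 ≤ w s := fun s hs => by simp only [hw]; positivity
  have hscaleint : ∀ {E : Type} [NormedAddCommGroup E] [NormedSpace ℝ E] (G : Spc n → E)
      (s : ℝ), 0 < s →
      (w s * ((√(1 + s))⁻¹) ^ n) • ∫ y, G ((√(1 + s))⁻¹ • y) = w s • ∫ y, G y := by
    intro E _ _ G s hs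
    have hr : 0 < √(1 + s) := Real.sqrt_pos.2 (by linarith)
    rw [Measure.integral_comp_inv_smul, smul_smul, finrank_euclideanSpace_fin,
      abs_of_nonneg (by positivity)]
    congr 1
    rw [mul_assoc, ← mul_pow, inv_mul_cancel₀ hr.ne', one_pow, mul_one]
  have hwint : IntegrableOn w (Set.Ioc 0 t) := by
    refine (ContinuousOn.integrableOn_Icc ?_).mono_set Set.Ioc_subset_Icc_self
    refine ContinuousOn.div (by fun_prop) (by fun_prop) fun s hs => ?_
    have := hs.1
    positivity
  have hmeas : AEStronglyMeasurable F
      ((volume.restrict (Set.Ioc 0 t)).prod (volume : Measure (Spc n))) := by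
    have hvol : (volume.restrict (Set.Ioc 0 t)).prod (volume : Measure (Spc n)) =
        (volume : Measure (ℝ × Spc n)).restrict (Set.Ioc 0 t ×ˢ Set.univ) := by
      rw [Measure.volume_eq_prod, ← Measure.prod_restrict, Measure.restrict_univ]
    rw [hvol]
    refine ContinuousOn.aestronglyMeasurable ?_ (measurableSet_Ioc.prod MeasurableSet.univ)
    refine ContinuousOn.smul (f := fun sy : ℝ × Spc n => (-sy.1) ^ l * ∏ h, (-(sy.2 h)) ^ (β h))
      (by fun_prop) ?_
    refine hcont.comp (f := fun q : ℝ × Spc n => (1 + q.1, q.2)) (by fun_prop) ?_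
    rintro ⟨s, y⟩ ⟨hs, -⟩
    have := hs.1
    simp only [Set.mem_prod, Set.mem_Ioi, Set.mem_univ, and_true]
    linarith
  have hFint : Integrable F ((volume.restrict (Set.Ioc 0 t)).prod volume) := by
    rw [integrable_prod_iff hmeas]
    constructor
    · filter_upwards [ae_restrict_mem measurableSet_Ioc] with s hs
      simp_rw [hslice s hs.1]
      have hr : 0 < √(1 + s) := Real.sqrt_pos.2 (by linarith [hs.1])
      exact (hgint.comp_smul (inv_ne_zero hr.ne')).fun_smul _
    · refine (hwint.mul_const (∫ y, ‖g y‖)).congr ?_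
      filter_upwards [ae_restrict_mem measurableSet_Ioc] with s hs
      have hnn : 0 ≤ w s * ((√(1 + s))⁻¹) ^ n := mul_nonneg (hwnn s hs.1) (by positivity)
      simp_rw [hslice s hs.1, norm_smul, Real.norm_of_nonneg hnn]
      rw [integral_const_mul]
      exact (hscaleint (fun y => ‖g y‖) s hs.1).symm
  rw [Measure.volume_eq_prod, ← Measure.prod_restrict, Measure.restrict_univ,
    integral_prod F hFint, intervalIntegral.integral_of_le ht, ← integral_smul_const]
  refine setIntegral_congr_fun measurableSet_Ioc fun s hs => ?_
  simp only [hslice s hs.1]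
  rw [integral_smul]
  exact hscaleint g s hs.1

/-- Claim 3.2 of the paper: for `n+1 ≤ 2l+|β| ≤ 2n`, `p = 2l+|β|+2` and a
continuous `f` with parabolic scaling of order `p` and `(1+|y|)^{|β|} f(1,·) ∈ L¹`, there is a
polynomial `Q` (componentwise, real, of degree ≤ ⌊n−l−|β|/2⌋) with
`∫₀^t∫ (−s)^l (−y)^β f(1+s,y) dy ds
  = log t ∫ (−1)^l (−y)^β f(1,y) dy + Q(t^{−1}) + o(t^{−n+l+|β|/2})` as `t → ∞`. -/
theorem log_evolution_of_moment (n : ℕ) (hn : 2 ≤ n) (l : ℕ) (β : Fin n → ℕ)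
    (hlow : n + 1 ≤ 2 * l + ∑ h, β h) (hhigh : 2 * l + ∑ h, β h ≤ 2 * n)
    (f : ℝ → Spc n → Spc n)
    (hcont : ContinuousOn (fun q : ℝ × Spc n => f q.1 q.2) (Set.Ioi 0 ×ˢ Set.univ))
    (hscale : ∀ lam > (0:ℝ), ∀ t > (0:ℝ), ∀ x : Spc n,
      lam ^ (n + (2 * l + (∑ h, β h) + 2)) • f (lam ^ 2 * t) (lam • x) = f t x)
    (hint : Integrable (fun y : Spc n => (1 + ‖y‖) ^ (∑ h, β h) • f 1 y) volume) :
    ∃ Q : Fin n → Polynomial ℝ,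
      (∀ c, (Q c).natDegree ≤ (2 * n - 2 * l - ∑ h, β h) / 2)
      ∧ Tendsto (fun t : ℝ =>
          t ^ ((n : ℝ) - (l : ℝ) - (∑ h, (β h : ℝ)) / 2) *
            ‖(∫ sy in (Set.Ioc (0:ℝ) t) ×ˢ (Set.univ : Set (Spc n)),
                ((-sy.1) ^ l * ∏ h, (-(sy.2 h)) ^ (β h)) • f (1 + sy.1) sy.2)
              - Real.log t • (∫ y : Spc n, ((-1 : ℝ) ^ l * ∏ h, (-(y h)) ^ (β h)) • f 1 y)
              - (EuclideanSpace.equiv (Fin n) ℝ).symm (fun c => (Q c).eval t⁻¹)‖)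
          atTop (𝓝 0) := by
  set L : Spc n := ∫ y : Spc n, ((-1 : ℝ) ^ l * ∏ h, (-(y h)) ^ (β h)) • f 1 y
  set K := (2 * n - 2 * l - ∑ h, β h) / 2 with hK
  have hA : AnalyticAt ℝ (fun x : ℝ => Real.log (1 + x) -
      ∑ j ∈ Finset.range l, ((1 + x)⁻¹) ^ (j + 1) / ((j : ℝ) + 1)) 0 := by
    have hadd : AnalyticAt ℝ (fun x : ℝ => 1 + x) 0 := analyticAt_const.add analyticAt_id
    refine (hadd.log (by simp)).sub (Finset.analyticAt_fun_sum _ fun j _ => ?_)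
    exact ((hadd.inv (by simp)).pow _).div analyticAt_const (by positivity)
  obtain ⟨P, hPdeg, hP⟩ := hA.exists_polynomial_isBigO K
  refine ⟨fun c => Polynomial.C (L c) * P,
    fun c => (Polynomial.natDegree_C_mul_le _ _).trans hPdeg, ?_⟩
  set γ : ℝ := (n : ℝ) - (l : ℝ) - (∑ h, (β h : ℝ)) / 2 with hγ
  have hγK : γ < (K : ℝ) + 1 := by
    have h1 : 2 * n < 2 * l + (∑ h, β h) + 2 * (K + 1) := by omega
    have h2 : (2 * n : ℝ) < 2 * l + (∑ h, (β h : ℝ)) + 2 * (K + 1) := by exact_mod_cast h1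
    linarith
  set R : ℝ → ℝ := fun x => Real.log (1 + x) -
      ∑ j ∈ Finset.range l, ((1 + x)⁻¹) ^ (j + 1) / ((j : ℝ) + 1) - P.eval x with hR
  have hbig : (fun t : ℝ => t ^ γ * ‖R t⁻¹ • L‖) =O[atTop]
      fun t : ℝ => t ^ (γ - ((K : ℝ) + 1)) := by
    have h1 : (fun t : ℝ => ‖R t⁻¹ • L‖) =O[atTop] fun t : ℝ => t⁻¹ ^ (K + 1) := by
      have h2 := hP.comp_tendsto tendsto_inv_atTop_zero
      simp_rw [norm_smul, mul_comm _ ‖L‖]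
      exact (h2.norm_left).const_mul_left _
    refine ((Asymptotics.isBigO_refl (fun t : ℝ => t ^ γ) atTop).mul h1).congr'
      EventuallyEq.rfl ?_
    filter_upwards [eventually_gt_atTop 0] with t ht
    rw [Real.rpow_sub ht γ, ← Nat.cast_add_one, Real.rpow_natCast, inv_pow, div_eq_mul_inv]
  have hzero : Tendsto (fun t : ℝ => t ^ (γ - ((K : ℝ) + 1))) atTop (𝓝 0) := by
    have := tendsto_rpow_neg_atTop (y := (K : ℝ) + 1 - γ) (by linarith)
    simpa using this
  refine (hbig.trans_tendsto hzero).congr' ?_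
  filter_upwards [eventually_gt_atTop 0] with t ht
  rw [setIntegral_moment_eq_smul β f hcont hscale hint ht.le,
    integral_pow_div_one_add_pow l ht.le]
  have hQ : (EuclideanSpace.equiv (Fin n) ℝ).symm
      (fun c => (Polynomial.C (L c) * P).eval t⁻¹) = P.eval t⁻¹ • L := by
    ext c
    simp [mul_comm]
  have hfrac : (1 + t⁻¹)⁻¹ = t / (1 + t) := by
    field_simp
    ring
  have hlog : Real.log (1 + t⁻¹) = Real.log (1 + t) - Real.log t := by
    rw [← Real.log_div (by positivity) ht.ne']
    congr 1
    field_simp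
    ring
  rw [hQ, ← sub_smul, ← sub_smul, hR]
  simp only [hfrac, hlog]
  congr 3
  ring
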